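/- For every even rational parameter p/q and every integer unit square, the grid light set of the square coincides with its tile light set. In particular, every integer unit square has either 0 or 2 good edges. -/

import Mathlib

noncomputable section
open scoped Classical

/-- The representative of `x` modulo `2ℤ` lying in `[-1,1)`.  For the values arising in the
plaid model (which are never congruent to an odd integer modulo `2ℤ`) this is the unique
representative in `(-1,1)`. -/
def nrm (x : ℝ) : ℝ := x - 2 * ⌊(x + 1) / 2⌋

/-- An even rational parameter `p/q`: coprime positive integers `p < q` with `p*q` even. -/
structure Param where
  p : ℕ
  q : ℕ
  p_pos : 0 < p
  p_lt_q : p < q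
  coprime : Nat.Coprime p q
  even_pq : Even (p * q)

/-- `z` lies on a line of the family `𝓗` (horizontal lines with integer `y`-coordinate). -/
def onH (z : ℝ × ℝ) : Prop := ∃ n : ℤ, z.2 = (n : ℝ)

/-- `z` lies on a line of the family `𝓥` (vertical lines with integer `x`-coordinate). -/
def onV (z : ℝ × ℝ) : Prop := ∃ n : ℤ, z.1 = (n : ℝ)

/-- The lightness condition on the pair of values `(F_A(z), F_B(z))`:
`F_A(z)·F_B(z) > 0` and `|F_B(z)| < |F_A(z)|`. -/
def lightPair (a b : ℝ) : Prop := a * b > 0 ∧ |b| < |a|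

namespace Param

variable (π : Param)

def ω : ℕ := π.p + π.q

def P : ℝ := 2 * π.p / π.ω

def Q : ℝ := 2 * π.q / π.ω

/-- `z` lies on a line of `𝓟` (slope `-P`, integer `y`-intercept). -/
def onP (z : ℝ × ℝ) : Prop := ∃ n : ℤ, z.2 + π.P * z.1 = (n : ℝ)

/-- `z` lies on a line of `𝓠` (slope `-Q`, integer `y`-intercept). -/
def onQ (z : ℝ × ℝ) : Prop := ∃ n : ℤ, z.2 + π.Q * z.1 = (n : ℝ)

def FH (z : ℝ × ℝ) : ℝ := nrm (2 * π.P * z.2)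
def FV (z : ℝ × ℝ) : ℝ := nrm (2 * π.P * z.1)
def FP (z : ℝ × ℝ) : ℝ := nrm (π.P * z.2 + π.P ^ 2 * z.1 + 1)
def FQ (z : ℝ × ℝ) : ℝ := nrm (π.P * z.2 + π.P * π.Q * z.1 + 1)

/-- `z` is a light intersection point of type `P` on a horizontal (`𝓗`) line. -/
def lightHP (z : ℝ × ℝ) : Prop := onH z ∧ π.onP z ∧ lightPair (π.FH z) (π.FP z)

/-- `z` is a light intersection point of type `Q` on a horizontal (`𝓗`) line. -/
def lightHQ (z : ℝ × ℝ) : Prop := onH z ∧ π.onQ z ∧ lightPair (π.FH z) (π.FQ z)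

/-- `z` is a light intersection point of type `P` on a vertical (`𝓥`) line. -/
def lightVP (z : ℝ × ℝ) : Prop := onV z ∧ π.onP z ∧ lightPair (π.FV z) (π.FP z)

/-- `z` is a light intersection point of type `Q` on a vertical (`𝓥`) line. -/
def lightVQ (z : ℝ × ℝ) : Prop := onV z ∧ π.onQ z ∧ lightPair (π.FV z) (π.FQ z)

/-- `z` is a light point (of some kind). -/
def light (z : ℝ × ℝ) : Prop := π.lightHP z ∨ π.lightHQ z ∨ π.lightVP z ∨ π.lightVQ z

/-- The number of light points, with the double-counting convention (a light point which is the
midpoint of the segment, lying simultaneously on a `𝓟` line and a `𝓠` line, counts twice), on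
the horizontal unit segment from `(m,n)` to `(m+1,n)`. -/
def hLightCount (m n : ℤ) : ℕ :=
  Set.ncard {x : ℝ | x ∈ Set.Icc (m : ℝ) ((m : ℝ) + 1) ∧ π.lightHP (x, (n : ℝ))} +
  Set.ncard {x : ℝ | x ∈ Set.Icc (m : ℝ) ((m : ℝ) + 1) ∧ π.lightHQ (x, (n : ℝ)) ∧
    (π.onP (x, (n : ℝ)) → x = (m : ℝ) + 1 / 2)}

/-- The number of light points on the vertical unit segment from `(m,n)` to `(m,n+1)`. -/
def vLightCount (m n : ℤ) : ℕ :=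
  Set.ncard {y : ℝ | y ∈ Set.Icc (n : ℝ) ((n : ℝ) + 1) ∧ π.lightVP ((m : ℝ), y)} +
  Set.ncard {y : ℝ | y ∈ Set.Icc (n : ℝ) ((n : ℝ) + 1) ∧ π.lightVQ ((m : ℝ), y)}

/-- The horizontal unit segment from `(m,n)` to `(m+1,n)` is good: it contains exactly one
light point (with the double-counting convention). -/
def goodH (m n : ℤ) : Prop := π.hLightCount m n = 1

/-- The vertical unit segment from `(m,n)` to `(m,n+1)` is good. -/
def goodV (m n : ℤ) : Prop := π.vLightCount m n = 1

end Param

/-- The set `𝓒` of centers of integer unit squares: `(ℤ + 1/2)²`. -/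
def CSet : Set (ℝ × ℝ) := {z | ∃ m n : ℤ, z = ((m : ℝ) + 1 / 2, (n : ℝ) + 1 / 2)}

/-- The classifying map `Ξ(x,y) = (2Px + 2y, 2Px, 2Px + 2Py)` (before taking the quotient by
the lattice `Λ_P`). -/
def Xi (P : ℝ) (z : ℝ × ℝ) : ℝ × ℝ × ℝ :=
  (2 * P * z.1 + 2 * z.2, 2 * P * z.1, 2 * P * z.1 + 2 * P * z.2)

/-- Membership in the lattice `Λ_P ⊂ ℝ³` generated by `(2,P,P)`, `(0,2,0)`, `(0,0,2)`. -/
def ΛMem (P : ℝ) (v : ℝ × ℝ × ℝ) : Prop :=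
  ∃ a b c : ℤ, v = ((2 * a : ℝ), (a : ℝ) * P + 2 * b, (a : ℝ) * P + 2 * c)

/-- The equivalence `z ∼ z'` modulo the lattice `L ⊂ ℤ²` generated by `(ω²,0)` and `(0,ω)`. -/
def LRel (ω : ℕ) (z z' : ℝ × ℝ) : Prop :=
  ∃ a b : ℤ, z' - z = ((ω : ℝ) ^ 2 * a, (ω : ℝ) * b)

/-- The set `𝒳 = (ℤ_odd/ω) × (ℤ_even/ω) × (ℤ_even/ω) ⊂ ℝ³`. -/
def XSet (ω : ℕ) : Set (ℝ × ℝ × ℝ) :=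
  {v | ∃ a b c : ℤ, Odd a ∧ Even b ∧ Even c ∧
        v = ((a : ℝ) / ω, (b : ℝ) / ω, (c : ℝ) / ω)}

/-- The representative of `v ∈ ℝ³` modulo the lattice `Λ_P` lying in the fundamental domain
`[-1,1)³`: first subtract the appropriate multiple of `(2,P,P)`, then reduce the last two
coordinates mod `2ℤ`. -/
def repΛ (P : ℝ) (v : ℝ × ℝ × ℝ) : ℝ × ℝ × ℝ :=
  (nrm v.1, nrm (v.2.1 - (⌊(v.1 + 1) / 2⌋ : ℤ) * P), nrm (v.2.2 - (⌊(v.1 + 1) / 2⌋ : ℤ) * P))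

/-- The four edges of a unit square. -/
inductive Edge
  | N | S | E | W
deriving DecidableEq

/-- The column (1,2,3,4, from left to right) of the 4×4 checkerboard partition of `[-1,1]²`
with cutoffs `u₁ ≤ u₂ ≤ u₃` containing a point with first coordinate `x`. -/
def colIdx (u₁ u₂ u₃ x : ℝ) : ℕ :=
  if x < u₁ then 1 else if x < u₂ then 2 else if x < u₃ then 3 else 4

/-- The row (1,2,3,4, from top to bottom) of the checkerboard containing a point with second
coordinate `y`. -/
def rowIdx (u₁ u₂ u₃ y : ℝ) : ℕ :=
  if u₃ < y then 1 else if u₂ < y then 2 else if u₁ < y then 3 else 4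

/-- Zone 1 (`T ∈ [-1,-1+P]`): letters of the special squares, by row (from the top). -/
def rowL₁ : ℕ → Edge | 1 => .W | 2 => .N | 3 => .E | _ => .S
/-- Zone 1: letters of the special squares, by column (from the left). -/
def colL₁ : ℕ → Edge | 1 => .N | 2 => .E | 3 => .S | _ => .W
/-- Zone 2 (`T ∈ [-1+P,1-P]`): letters by row. -/
def rowL₂ : ℕ → Edge | 1 => .N | 2 => .E | 3 => .W | _ => .S
/-- Zone 2: letters by column. -/
def colL₂ : ℕ → Edge | 1 => .N | 2 => .W | 3 => .E | _ => .S
/-- Zone 3 (`T ∈ [1-P,1]`): letters by row. -/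
def rowL₃ : ℕ → Edge | 1 => .N | 2 => .W | 3 => .S | _ => .E
/-- Zone 3: letters by column. -/
def colL₃ : ℕ → Edge | 1 => .E | 2 => .N | 3 => .W | _ => .S

/-- The pair of letters (row letter, column letter) of the piece of the partition of `X_P`
containing the point of `[-1,1)³` with coordinates `v = (T, U₁, U₂)`.  The cell of the
checkerboard is special exactly when the two letters agree, in which case the assigned tile is
empty; otherwise the assigned tile has the connector joining the two edges. -/
def tileLetters (P : ℝ) (v : ℝ × ℝ × ℝ) : Edge × Edge :=
  let T := v.1
  let U₁ := v.2.1
  let U₂ := v.2.2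
  if T ≤ -1 + P then
    (rowL₁ (rowIdx T (1 - P) (2 - P + T) U₂), colL₁ (colIdx T (1 - P) (2 - P + T) U₁))
  else if T ≤ 1 - P then
    (rowL₂ (rowIdx (-1 + P) T (1 - P) U₂), colL₂ (colIdx (-1 + P) T (1 - P) U₁))
  else
    (rowL₃ (rowIdx (-2 + P + T) (-1 + P) T U₂), colL₃ (colIdx (-2 + P + T) (-1 + P) T U₁))

/-- The tile light set of the square with center `c`: the edge `e` is joined by the connector
of the tile assigned to the square via the classifying map `Ξ`. -/
def tileLight (P : ℝ) (c : ℝ × ℝ) (e : Edge) : Prop :=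
  (tileLetters P (repΛ P (Xi P c))).1 ≠ (tileLetters P (repΛ P (Xi P c))).2 ∧
  (e = (tileLetters P (repΛ P (Xi P c))).1 ∨ e = (tileLetters P (repΛ P (Xi P c))).2)

/-- The grid light set of the integer unit square with corners `(m,n)`, `(m+1,n+1)`: the edge
`e` contains exactly one light point (with the double-counting convention). -/
def gridGood (π : Param) (m n : ℤ) : Edge → Prop
  | .S => π.goodH m n
  | .N => π.goodH m (n + 1)
  | .W => π.goodV m n
  | .E => π.goodV (m + 1) n

/-! ### Residues modulo `2ℤ` -/

/-- The representative of `x` modulo `2ℤ` in `[0,2)`. -/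
def res (x : ℝ) : ℝ := x - 2 * ⌊x / 2⌋

lemma res_nonneg (x : ℝ) : 0 ≤ res x := by
  have := Int.floor_le (x / 2)
  unfold res; linarith

lemma res_lt (x : ℝ) : res x < 2 := by
  have := Int.lt_floor_add_one (x / 2)
  unfold res; linarith

lemma res_eq (x : ℝ) (k : ℤ) (h0 : 0 ≤ x - 2 * k) (h1 : x - 2 * k < 2) : res x = x - 2 * k := by
  have : ⌊x / 2⌋ = k := by
    rw [Int.floor_eq_iff]; constructor <;> linarith
  unfold res; rw [this]

lemma res_spec (x : ℝ) : ∃ k : ℤ, x = res x + 2 * k := ⟨⌊x / 2⌋, by unfold res; ring⟩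

lemma res_congr {x y : ℝ} (k : ℤ) (h : x = y + 2 * k) : res x = res y := by
  obtain ⟨l, hl⟩ := res_spec y
  have h0 := res_nonneg y
  have h1 := res_lt y
  rw [res_eq x (l + k)] <;> push_cast <;> linarith

lemma res_cases (x : ℝ) (h0 : -4 ≤ x) (h1 : x < 4) :
    (x < -2 ∧ res x = x + 4) ∨ (-2 ≤ x ∧ x < 0 ∧ res x = x + 2) ∨ (0 ≤ x ∧ x < 2 ∧ res x = x) ∨
      (2 ≤ x ∧ res x = x - 2) := by
  rcases lt_or_ge x (-2) with h | h
  · left; refine ⟨h, ?_⟩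
    rw [res_eq x (-2)] <;> push_cast <;> linarith
  rcases lt_or_ge x 0 with h' | h'
  · right; left; refine ⟨h, h', ?_⟩
    rw [res_eq x (-1)] <;> push_cast <;> linarith
  rcases lt_or_ge x 2 with h'' | h''
  · right; right; left; refine ⟨h', h'', ?_⟩
    rw [res_eq x 0] <;> push_cast <;> linarith
  · right; right; right; refine ⟨h'', ?_⟩
    rw [res_eq x 1] <;> push_cast <;> linarith

lemma nrm_eq_res (x : ℝ) : (res x < 1 ∧ nrm x = res x) ∨ (1 ≤ res x ∧ nrm x = res x - 2) := by
  obtain ⟨k, hk⟩ := res_spec x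
  have h0 := res_nonneg x
  have h1 := res_lt x
  rcases lt_or_ge (res x) 1 with h | h
  · left; refine ⟨h, ?_⟩
    have : ⌊(x + 1) / 2⌋ = k := by
      rw [Int.floor_eq_iff]; constructor <;> linarith
    unfold nrm; rw [this]; linarith
  · right; refine ⟨h, ?_⟩
    have : ⌊(x + 1) / 2⌋ = k + 1 := by
      rw [Int.floor_eq_iff]; push_cast; constructor <;> linarith
    unfold nrm; rw [this]; push_cast; linarith

lemma nrm_spec (x : ℝ) : ∃ k : ℤ, nrm x = x + 2 * k :=
  ⟨-⌊(x + 1) / 2⌋, by unfold nrm; push_cast; ring⟩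

lemma nrm_bounds (x : ℝ) : -1 ≤ nrm x ∧ nrm x < 1 := by
  have := Int.floor_le ((x + 1) / 2)
  have := Int.lt_floor_add_one ((x + 1) / 2)
  unfold nrm; constructor <;> linarith

lemma lightPair_iff (a b : ℝ) : lightPair a b ↔ (0 < b ∧ b < a) ∨ (a < b ∧ b < 0) := by
  unfold lightPair
  constructor
  · rintro ⟨h1, h2⟩
    rcases pos_and_pos_or_neg_and_neg_of_mul_pos h1 with ⟨ha, hb⟩ | ⟨ha, hb⟩
    · left; rw [abs_of_pos ha, abs_of_pos hb] at h2; exact ⟨hb, h2⟩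
    · right; rw [abs_of_neg ha, abs_of_neg hb] at h2; exact ⟨by linarith, hb⟩
  · rintro (⟨h1, h2⟩ | ⟨h1, h2⟩)
    · have ha : 0 < a := by linarith
      rw [abs_of_pos ha, abs_of_pos h1]; exact ⟨mul_pos ha h1, h2⟩
    · have ha : a < 0 := by linarith
      rw [abs_of_neg ha, abs_of_neg h2]; exact ⟨mul_pos_of_neg_of_neg ha h2, by linarith⟩

lemma light_iff (x y : ℝ) (h0 : res y ≠ 0) (h1 : res y ≠ res x) (h2 : res x ≠ 1) :
    lightPair (nrm x) (nrm y) ↔ ¬ (res y < res x ↔ 1 < res x) := by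
  rw [lightPair_iff]
  have := res_nonneg x
  have := res_nonneg y
  have := res_lt x
  have := res_lt y
  rcases nrm_eq_res x with ⟨hx, ex⟩ | ⟨hx, ex⟩ <;> rcases nrm_eq_res y with ⟨hy, ey⟩ | ⟨hy, ey⟩ <;>
    rw [ex, ey] <;> grind

/-- Exactly one of two points is light, in terms of residues. -/
lemma light_xor (x y z : ℝ) (h0 : res y ≠ 0) (h1 : res y ≠ res x) (h0' : res z ≠ 0)
    (h1' : res z ≠ res x) (h2 : res x ≠ 1) :
    ¬ (lightPair (nrm x) (nrm y) ↔ lightPair (nrm x) (nrm z)) ↔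
      ¬ (res y < res x ↔ res z < res x) := by
  rw [light_iff x y h0 h1 h2, light_iff x z h0' h1' h2]
  tauto

lemma res_sub_cases (x y : ℝ) : (res y ≤ res x ∧ res (x - y) = res x - res y) ∨
    (res x < res y ∧ res (x - y) = res x - res y + 2) := by
  obtain ⟨k, hk⟩ := res_spec x
  obtain ⟨l, hl⟩ := res_spec y
  have := res_nonneg x
  have := res_nonneg y
  have := res_lt x
  have := res_lt y
  rcases le_or_gt (res y) (res x) with h | h
  · left; refine ⟨h, ?_⟩
    rw [res_eq (x - y) (k - l)] <;> push_cast <;> linarith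
  · right; refine ⟨h, ?_⟩
    rw [res_eq (x - y) (k - l - 1)] <;> push_cast <;> linarith

lemma res_zero : res 0 = 0 := by
  rw [res_eq 0 0] <;> norm_num

/-- Reflection symmetry of lightness. -/
lemma res_reflect (a b : ℝ) (h : res b ≠ 0) (h' : res b ≠ res a) : res (a - b) < res a ↔ res b < res a := by
  have := res_nonneg b
  have := res_lt b
  rcases res_sub_cases a b with ⟨h1, h2⟩ | ⟨h1, h2⟩ <;> rw [h2] <;> grind

/-- The pairs `{0,a}` and `{b,c}` separate each other on the circle: symmetric form. -/
lemma res_link (a b c : ℝ) (hb : res b ≠ 0) (hc : res c ≠ 0) (hba : res b ≠ res a)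
    (hca : res c ≠ res a) :
    ¬ (res b < res a ↔ res c < res a) ↔ ¬ (res (-b) < res (c - b) ↔ res (a - b) < res (c - b)) := by
  have := res_nonneg a
  have := res_nonneg b
  have := res_nonneg c
  have := res_lt a
  have := res_lt b
  have := res_lt c
  have h0 := res_sub_cases 0 b
  rw [res_zero, zero_sub] at h0
  rcases h0 with ⟨h1, h2⟩ | ⟨h1, h2⟩
  · grind
  rw [h2]
  rcases res_sub_cases a b with ⟨h3, h4⟩ | ⟨h3, h4⟩ <;> 
  rcases res_sub_cases c b with ⟨h5, h6⟩ | ⟨h5, h6⟩ <;> rw [h4, h6] <;> grind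

/-! ### Parity of numerators -/

/-- `x` is an even integer over `w`. -/
def Ev (w : ℤ) (x : ℝ) : Prop := ∃ k : ℤ, x * w = 2 * k
/-- `x` is an odd integer over `w`. -/
def Od (w : ℤ) (x : ℝ) : Prop := ∃ k : ℤ, x * w = 2 * k + 1

lemma Ev.add {w : ℤ} {x y : ℝ} : Ev w x → Ev w y → Ev w (x + y) := by
  rintro ⟨k, hk⟩ ⟨l, hl⟩; exact ⟨k + l, by push_cast; linarith⟩
lemma Ev.sub {w : ℤ} {x y : ℝ} : Ev w x → Ev w y → Ev w (x - y) := by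
  rintro ⟨k, hk⟩ ⟨l, hl⟩; exact ⟨k - l, by push_cast; linarith⟩
lemma Ev.add_od {w : ℤ} {x y : ℝ} : Ev w x → Od w y → Od w (x + y) := by
  rintro ⟨k, hk⟩ ⟨l, hl⟩; exact ⟨k + l, by push_cast; linarith⟩
lemma Ev.sub_od {w : ℤ} {x y : ℝ} : Ev w x → Od w y → Od w (x - y) := by
  rintro ⟨k, hk⟩ ⟨l, hl⟩; exact ⟨k - l - 1, by push_cast; linarith⟩
lemma Od.add_ev {w : ℤ} {x y : ℝ} : Od w x → Ev w y → Od w (x + y) := by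
  rintro ⟨k, hk⟩ ⟨l, hl⟩; exact ⟨k + l, by push_cast; linarith⟩
lemma Od.sub_ev {w : ℤ} {x y : ℝ} : Od w x → Ev w y → Od w (x - y) := by
  rintro ⟨k, hk⟩ ⟨l, hl⟩; exact ⟨k - l, by push_cast; linarith⟩
lemma Od.add {w : ℤ} {x y : ℝ} : Od w x → Od w y → Ev w (x + y) := by
  rintro ⟨k, hk⟩ ⟨l, hl⟩; exact ⟨k + l + 1, by push_cast; linarith⟩
lemma Od.sub {w : ℤ} {x y : ℝ} : Od w x → Od w y → Ev w (x - y) := by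
  rintro ⟨k, hk⟩ ⟨l, hl⟩; exact ⟨k - l, by push_cast; linarith⟩
lemma Od.ne {w : ℤ} {x y : ℝ} : Od w x → Ev w y → y ≠ x := by
  rintro ⟨k, hk⟩ ⟨l, hl⟩ rfl
  have : (2 * l : ℝ) = 2 * k + 1 := by linarith
  have : 2 * l = 2 * k + 1 := by exact_mod_cast this
  omega
lemma Ev.mul_int {w : ℤ} {x : ℝ} (n : ℤ) : Ev w x → Ev w (x * n) := by
  rintro ⟨k, hk⟩; exact ⟨k * n, by push_cast; linear_combination (n : ℝ) * hk⟩
lemma Ev.two_mul_int {w : ℤ} (n : ℤ) : Ev w (2 * n) := ⟨n * w, by push_cast; ring⟩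
lemma Ev.of_res {w : ℤ} {x : ℝ} (h : Ev w x) : Ev w (res x) := by
  obtain ⟨k, hk⟩ := res_spec x
  have := h.sub (Ev.two_mul_int k)
  rwa [hk, add_sub_cancel_right] at this
lemma Od.of_res {w : ℤ} {x : ℝ} (h : Od w x) : Od w (res x) := by
  obtain ⟨k, hk⟩ := res_spec x
  have := h.sub_ev (Ev.two_mul_int k)
  rwa [hk, add_sub_cancel_right] at this
lemma Ev.zero {w : ℤ} : Ev w 0 := ⟨0, by simp⟩
lemma Od.res_ne_zero {w : ℤ} {x : ℝ} (h : Od w x) : res x ≠ 0 := (h.of_res.ne Ev.zero).symm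
lemma Od.res_ne {w : ℤ} {x y : ℝ} (h : Od w x) (h' : Ev w y) : res x ≠ res y :=
  (h.of_res.ne h'.of_res).symm

/-! ### The arithmetic of the partition, zone by zone -/

/-- The data of a generic point `(T,U₁,U₂)` in the fundamental domain. -/
structure Gen (w : ℤ) (P T U₁ U₂ : ℝ) : Prop where
  P0 : 0 < P
  P1 : P < 1
  T0 : -1 ≤ T
  T1 : T < 1
  V0 : -1 ≤ U₁
  V1 : U₁ < 1
  W0 : -1 ≤ U₂
  W1 : U₂ < 1
  one : Od w 1
  eP : Ev w P
  eT : Od w T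
  eV : Ev w U₁
  eW : Ev w U₂

/-- A finite list of order facts making all comparisons strict. -/
lemma cut_ne {w : ℤ} {P T U : ℝ} (one : Od w 1) (eP : Ev w P) (eT : Od w T) (eU : Ev w U) :
    U ≠ -1 ∧ U ≠ T ∧ U ≠ 1 - P ∧ U ≠ -1 + P ∧ U ≠ 2 - P + T ∧ U ≠ -2 + P + T := by
  have m1 : Od w (-1) := by simpa using Ev.zero.sub_od one
  have e2 : Ev w 2 := by simpa using Ev.two_mul_int (w := w) 1
  have em2 : Ev w (-2) := by simpa using Ev.two_mul_int (w := w) (-1)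
  exact ⟨m1.ne eU, eT.ne eU, (one.sub_ev eP).ne eU, (m1.add_ev eP).ne eU,
    ((e2.sub eP).add_od eT).ne eU, ((em2.add eP).add_od eT).ne eU⟩

lemma W1 {w : ℤ} {P T U₁ U₂ : ℝ} (g : Gen w P T U₁ U₂) (hT : T < -1 + P) :
    ¬ (res (T - U₁ - P) < res (T + 1 - P) ↔ res (U₂ + 1) < res (T + 1 - P)) ↔
      ¬ (Edge.W = rowL₁ (rowIdx T (1 - P) (2 - P + T) U₂) ↔ Edge.W = colL₁ (colIdx T (1 - P) (2 - P + T) U₁)) := by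
  obtain ⟨P0, P1, T0, T1, V0, V1, W0, W1, one, eP, eT, eV, eW⟩ := g
  obtain ⟨c1, c2, c3, c4, c5, c6⟩ := cut_ne one eP eT eV
  obtain ⟨d1, d2, d3, d4, d5, d6⟩ := cut_ne one eP eT eW
  have ra : res (T + 1 - P) = T + 3 - P := by
    rw [res_eq (T + 1 - P) (-1)] <;> push_cast <;> linarith
  rw [ra]
  have h1 : res (T - U₁ - P) < T + 3 - P ↔ ¬ (Edge.W = colL₁ (colIdx T (1 - P) (2 - P + T) U₁)) := by
    rcases res_cases (T - U₁ - P) (by linarith) (by linarith) with h | h | h | h <;>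
      simp only [colIdx] <;> split_ifs <;> simp [colL₁] <;> grind
  have h2 : res (U₂ + 1) < T + 3 - P ↔ ¬ (Edge.W = rowL₁ (rowIdx T (1 - P) (2 - P + T) U₂)) := by
    rcases res_cases (U₂ + 1) (by linarith) (by linarith) with h | h | h | h <;>
      simp only [rowIdx] <;> split_ifs <;> simp [rowL₁] <;> grind
  rw [h1, h2]; tauto

lemma W2 {w : ℤ} {P T U₁ U₂ : ℝ} (g : Gen w P T U₁ U₂) (hT : -1 + P < T) (hT' : T < 1 - P) :
    ¬ (res (T - U₁) < res (T + 1 - P) ↔ res (U₂ + 1 - P) < res (T + 1 - P)) ↔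
      ¬ (Edge.W = rowL₂ (rowIdx (-1 + P) T (1 - P) U₂) ↔ Edge.W = colL₂ (colIdx (-1 + P) T (1 - P) U₁)) := by
  obtain ⟨P0, P1, T0, T1, V0, V1, W0, W1, one, eP, eT, eV, eW⟩ := g
  obtain ⟨c1, c2, c3, c4, c5, c6⟩ := cut_ne one eP eT eV
  obtain ⟨d1, d2, d3, d4, d5, d6⟩ := cut_ne one eP eT eW
  have ra : res (T + 1 - P) = T + 1 - P := by
    rw [res_eq (T + 1 - P) (0)] <;> push_cast <;> linarith
  rw [ra]
  have h1 : res (T - U₁) < T + 1 - P ↔ Edge.W = colL₂ (colIdx (-1 + P) T (1 - P) U₁) := by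
    rcases res_cases (T - U₁) (by linarith) (by linarith) with h | h | h | h <;>
      simp only [colIdx] <;> split_ifs <;> simp [colL₂] <;> grind
  have h2 : res (U₂ + 1 - P) < T + 1 - P ↔ Edge.W = rowL₂ (rowIdx (-1 + P) T (1 - P) U₂) := by
    rcases res_cases (U₂ + 1 - P) (by linarith) (by linarith) with h | h | h | h <;>
      simp only [rowIdx] <;> split_ifs <;> simp [rowL₂] <;> grind
  rw [h1, h2]; tauto

lemma W3 {w : ℤ} {P T U₁ U₂ : ℝ} (g : Gen w P T U₁ U₂) (hT : 1 - P ≤ T) :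
    ¬ (res (T - U₁) < res (T + 1 - P) ↔ res (U₂ + 1 - P) < res (T + 1 - P)) ↔
      ¬ (Edge.W = rowL₃ (rowIdx (-2 + P + T) (-1 + P) T U₂) ↔ Edge.W = colL₃ (colIdx (-2 + P + T) (-1 + P) T U₁)) := by
  obtain ⟨P0, P1, T0, T1, V0, V1, W0, W1, one, eP, eT, eV, eW⟩ := g
  obtain ⟨c1, c2, c3, c4, c5, c6⟩ := cut_ne one eP eT eV
  obtain ⟨d1, d2, d3, d4, d5, d6⟩ := cut_ne one eP eT eW
  have ra : res (T + 1 - P) = T + 1 - P := by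
    rw [res_eq (T + 1 - P) (0)] <;> push_cast <;> linarith
  rw [ra]
  have h1 : res (T - U₁) < T + 1 - P ↔ Edge.W = colL₃ (colIdx (-2 + P + T) (-1 + P) T U₁) := by
    rcases res_cases (T - U₁) (by linarith) (by linarith) with h | h | h | h <;>
      simp only [colIdx] <;> split_ifs <;> simp [colL₃] <;> grind
  have h2 : res (U₂ + 1 - P) < T + 1 - P ↔ Edge.W = rowL₃ (rowIdx (-2 + P + T) (-1 + P) T U₂) := by
    rcases res_cases (U₂ + 1 - P) (by linarith) (by linarith) with h | h | h | h <;>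
      simp only [rowIdx] <;> split_ifs <;> simp [rowL₃] <;> grind
  rw [h1, h2]; tauto

lemma E1 {w : ℤ} {P T U₁ U₂ : ℝ} (g : Gen w P T U₁ U₂) (hT : T ≤ -1 + P) :
    ¬ (res (T - U₁) < res (T + 1 + P) ↔ res (U₂ + 1 + P) < res (T + 1 + P)) ↔
      ¬ (Edge.E = rowL₁ (rowIdx T (1 - P) (2 - P + T) U₂) ↔ Edge.E = colL₁ (colIdx T (1 - P) (2 - P + T) U₁)) := by
  obtain ⟨P0, P1, T0, T1, V0, V1, W0, W1, one, eP, eT, eV, eW⟩ := g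
  obtain ⟨c1, c2, c3, c4, c5, c6⟩ := cut_ne one eP eT eV
  obtain ⟨d1, d2, d3, d4, d5, d6⟩ := cut_ne one eP eT eW
  have ra : res (T + 1 + P) = T + 1 + P := by
    rw [res_eq (T + 1 + P) (0)] <;> push_cast <;> linarith
  rw [ra]
  have h1 : res (T - U₁) < T + 1 + P ↔ ¬ (Edge.E = colL₁ (colIdx T (1 - P) (2 - P + T) U₁)) := by
    rcases res_cases (T - U₁) (by linarith) (by linarith) with h | h | h | h <;>
      simp only [colIdx] <;> split_ifs <;> simp [colL₁] <;> grind
  have h2 : res (U₂ + 1 + P) < T + 1 + P ↔ ¬ (Edge.E = rowL₁ (rowIdx T (1 - P) (2 - P + T) U₂)) := by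
    rcases res_cases (U₂ + 1 + P) (by linarith) (by linarith) with h | h | h | h <;>
      simp only [rowIdx] <;> split_ifs <;> simp [rowL₁] <;> grind
  rw [h1, h2]; tauto

lemma E2 {w : ℤ} {P T U₁ U₂ : ℝ} (g : Gen w P T U₁ U₂) (hT : -1 + P < T) (hT' : T < 1 - P) :
    ¬ (res (T - U₁) < res (T + 1 + P) ↔ res (U₂ + 1 + P) < res (T + 1 + P)) ↔
      ¬ (Edge.E = rowL₂ (rowIdx (-1 + P) T (1 - P) U₂) ↔ Edge.E = colL₂ (colIdx (-1 + P) T (1 - P) U₁)) := by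
  obtain ⟨P0, P1, T0, T1, V0, V1, W0, W1, one, eP, eT, eV, eW⟩ := g
  obtain ⟨c1, c2, c3, c4, c5, c6⟩ := cut_ne one eP eT eV
  obtain ⟨d1, d2, d3, d4, d5, d6⟩ := cut_ne one eP eT eW
  have ra : res (T + 1 + P) = T + 1 + P := by
    rw [res_eq (T + 1 + P) (0)] <;> push_cast <;> linarith
  rw [ra]
  have h1 : res (T - U₁) < T + 1 + P ↔ ¬ (Edge.E = colL₂ (colIdx (-1 + P) T (1 - P) U₁)) := by
    rcases res_cases (T - U₁) (by linarith) (by linarith) with h | h | h | h <;>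
      simp only [colIdx] <;> split_ifs <;> simp [colL₂] <;> grind
  have h2 : res (U₂ + 1 + P) < T + 1 + P ↔ ¬ (Edge.E = rowL₂ (rowIdx (-1 + P) T (1 - P) U₂)) := by
    rcases res_cases (U₂ + 1 + P) (by linarith) (by linarith) with h | h | h | h <;>
      simp only [rowIdx] <;> split_ifs <;> simp [rowL₂] <;> grind
  rw [h1, h2]; tauto

lemma E3 {w : ℤ} {P T U₁ U₂ : ℝ} (g : Gen w P T U₁ U₂) (hT : 1 - P < T) :
    ¬ (res (T - U₁ + P) < res (T + 1 + P) ↔ res (U₂ + 1) < res (T + 1 + P)) ↔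
      ¬ (Edge.E = rowL₃ (rowIdx (-2 + P + T) (-1 + P) T U₂) ↔ Edge.E = colL₃ (colIdx (-2 + P + T) (-1 + P) T U₁)) := by
  obtain ⟨P0, P1, T0, T1, V0, V1, W0, W1, one, eP, eT, eV, eW⟩ := g
  obtain ⟨c1, c2, c3, c4, c5, c6⟩ := cut_ne one eP eT eV
  obtain ⟨d1, d2, d3, d4, d5, d6⟩ := cut_ne one eP eT eW
  have ra : res (T + 1 + P) = T - 1 + P := by
    rw [res_eq (T + 1 + P) (1)] <;> push_cast <;> linarith
  rw [ra]
  have h1 : res (T - U₁ + P) < T - 1 + P ↔ Edge.E = colL₃ (colIdx (-2 + P + T) (-1 + P) T U₁) := by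
    rcases res_cases (T - U₁ + P) (by linarith) (by linarith) with h | h | h | h <;>
      simp only [colIdx] <;> split_ifs <;> simp [colL₃] <;> grind
  have h2 : res (U₂ + 1) < T - 1 + P ↔ Edge.E = rowL₃ (rowIdx (-2 + P + T) (-1 + P) T U₂) := by
    rcases res_cases (U₂ + 1) (by linarith) (by linarith) with h | h | h | h <;>
      simp only [rowIdx] <;> split_ifs <;> simp [rowL₃] <;> grind
  rw [h1, h2]; tauto

lemma S1 {w : ℤ} {P T U₁ U₂ : ℝ} (g : Gen w P T U₁ U₂) (hT : T ≤ -1 + P) :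
    ¬ (res (T - U₁ - P) < res (U₂ - U₁ - P) ↔ res (U₂ + 1) < res (U₂ - U₁ - P)) ↔
      ¬ (Edge.S = rowL₁ (rowIdx T (1 - P) (2 - P + T) U₂) ↔ Edge.S = colL₁ (colIdx T (1 - P) (2 - P + T) U₁)) := by
  obtain ⟨P0, P1, T0, T1, V0, V1, W0, W1, one, eP, eT, eV, eW⟩ := g
  obtain ⟨c1, c2, c3, c4, c5, c6⟩ := cut_ne one eP eT eV
  obtain ⟨d1, d2, d3, d4, d5, d6⟩ := cut_ne one eP eT eW
  have o1 : Od w (T - U₁ - P) := (eT.sub_ev eV).sub_ev eP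
  have o2 : Od w (U₂ + 1) := eW.add_od one
  have ea : Ev w (U₂ - U₁ - P) := (eW.sub eV).sub eP
  have er : U₂ - U₁ - P - (T - U₁ - P) = U₂ - T := by ring
  have o3 : Od w (U₂ - T) := er ▸ ea.sub_od o1
  rw [← res_reflect (U₂ - U₁ - P) (T - U₁ - P) o1.res_ne_zero (o1.res_ne ea), er]
  rw [res_link (U₂ - U₁ - P) (U₂ - T) (U₂ + 1) o3.res_ne_zero o2.res_ne_zero (o3.res_ne ea) (o2.res_ne ea)]
  have rc : res (U₂ + 1 - (U₂ - T)) = T + 1 := by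
    rw [res_eq _ (0)] <;> push_cast <;> linarith
  rw [rc, show -(U₂ - T) = T - U₂ by ring, show U₂ - U₁ - P - (U₂ - T) = T - U₁ - P by ring]
  have h1 : res (T - U₂) < T + 1 ↔ Edge.S = rowL₁ (rowIdx T (1 - P) (2 - P + T) U₂) := by
    rcases res_cases (T - U₂) (by linarith) (by linarith) with h | h | h | h <;>
      simp only [rowIdx] <;> split_ifs <;> simp [rowL₁] <;> grind
  have h2 : res (T - U₁ - P) < T + 1 ↔ Edge.S = colL₁ (colIdx T (1 - P) (2 - P + T) U₁) := by
    rcases res_cases (T - U₁ - P) (by linarith) (by linarith) with h | h | h | h <;>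
      simp only [colIdx] <;> split_ifs <;> simp [colL₁] <;> grind
  rw [h1, h2]

lemma S2 {w : ℤ} {P T U₁ U₂ : ℝ} (g : Gen w P T U₁ U₂) (hT : -1 + P < T) (hT' : T < 1 - P) :
    ¬ (res (U₂ + 1 - P) < res (U₂ - U₁ - P) ↔ res (U₂ + 1) < res (U₂ - U₁ - P)) ↔
      ¬ (Edge.S = rowL₂ (rowIdx (-1 + P) T (1 - P) U₂) ↔ Edge.S = colL₂ (colIdx (-1 + P) T (1 - P) U₁)) := by
  obtain ⟨P0, P1, T0, T1, V0, V1, W0, W1, one, eP, eT, eV, eW⟩ := g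
  obtain ⟨c1, c2, c3, c4, c5, c6⟩ := cut_ne one eP eT eV
  obtain ⟨d1, d2, d3, d4, d5, d6⟩ := cut_ne one eP eT eW
  have o1 : Od w (U₂ + 1 - P) := (eW.add_od one).sub_ev eP
  have o2 : Od w (U₂ + 1) := eW.add_od one
  have ea : Ev w (U₂ - U₁ - P) := (eW.sub eV).sub eP
  rw [res_link (U₂ - U₁ - P) (U₂ + 1 - P) (U₂ + 1) o1.res_ne_zero o2.res_ne_zero (o1.res_ne ea) (o2.res_ne ea)]
  have rc : res (U₂ + 1 - (U₂ + 1 - P)) = P := by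
    rw [res_eq _ (0)] <;> push_cast <;> linarith
  rw [rc, show -(U₂ + 1 - P) = P - 1 - U₂ by ring, show U₂ - U₁ - P - (U₂ + 1 - P) = -1 - U₁ by ring]
  have h1 : res (P - 1 - U₂) < P ↔ Edge.S = rowL₂ (rowIdx (-1 + P) T (1 - P) U₂) := by
    rcases res_cases (P - 1 - U₂) (by linarith) (by linarith) with h | h | h | h <;>
      simp only [rowIdx] <;> split_ifs <;> simp [rowL₂] <;> grind
  have h2 : res (-1 - U₁) < P ↔ Edge.S = colL₂ (colIdx (-1 + P) T (1 - P) U₁) := by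
    rcases res_cases (-1 - U₁) (by linarith) (by linarith) with h | h | h | h <;>
      simp only [colIdx] <;> split_ifs <;> simp [colL₂] <;> grind
  rw [h1, h2]

lemma S3 {w : ℤ} {P T U₁ U₂ : ℝ} (g : Gen w P T U₁ U₂) (hT : 1 - P ≤ T) :
    ¬ (res (T - U₁) < res (U₂ - U₁ - P) ↔ res (U₂ + 1 - P) < res (U₂ - U₁ - P)) ↔
      ¬ (Edge.S = rowL₃ (rowIdx (-2 + P + T) (-1 + P) T U₂) ↔ Edge.S = colL₃ (colIdx (-2 + P + T) (-1 + P) T U₁)) := by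
  obtain ⟨P0, P1, T0, T1, V0, V1, W0, W1, one, eP, eT, eV, eW⟩ := g
  obtain ⟨c1, c2, c3, c4, c5, c6⟩ := cut_ne one eP eT eV
  obtain ⟨d1, d2, d3, d4, d5, d6⟩ := cut_ne one eP eT eW
  have o1 : Od w (T - U₁) := eT.sub_ev eV
  have o2 : Od w (U₂ + 1 - P) := (eW.add_od one).sub_ev eP
  have ea : Ev w (U₂ - U₁ - P) := (eW.sub eV).sub eP
  have er : U₂ - U₁ - P - (T - U₁) = U₂ - P - T := by ring
  have o3 : Od w (U₂ - P - T) := er ▸ ea.sub_od o1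
  rw [← res_reflect (U₂ - U₁ - P) (T - U₁) o1.res_ne_zero (o1.res_ne ea), er]
  rw [not_congr (Iff.comm)]
  rw [res_link (U₂ - U₁ - P) (U₂ + 1 - P) (U₂ - P - T) o2.res_ne_zero o3.res_ne_zero (o2.res_ne ea) (o3.res_ne ea)]
  have rc : res (U₂ - P - T - (U₂ + 1 - P)) = 1 - T := by
    rw [res_eq _ (-1)] <;> push_cast <;> linarith
  rw [rc, show -(U₂ + 1 - P) = P - 1 - U₂ by ring, show U₂ - U₁ - P - (U₂ + 1 - P) = -1 - U₁ by ring]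
  have h1 : res (P - 1 - U₂) < 1 - T ↔ Edge.S = rowL₃ (rowIdx (-2 + P + T) (-1 + P) T U₂) := by
    rcases res_cases (P - 1 - U₂) (by linarith) (by linarith) with h | h | h | h <;>
      simp only [rowIdx] <;> split_ifs <;> simp [rowL₃] <;> grind
  have h2 : res (-1 - U₁) < 1 - T ↔ Edge.S = colL₃ (colIdx (-2 + P + T) (-1 + P) T U₁) := by
    rcases res_cases (-1 - U₁) (by linarith) (by linarith) with h | h | h | h <;>
      simp only [colIdx] <;> split_ifs <;> simp [colL₃] <;> grind
  rw [h1, h2]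

lemma N1 {w : ℤ} {P T U₁ U₂ : ℝ} (g : Gen w P T U₁ U₂) (hT : T ≤ -1 + P) :
    ¬ (res (T - U₁) < res (U₂ - U₁ + P) ↔ res (U₂ + 1 + P) < res (U₂ - U₁ + P)) ↔
      ¬ (Edge.N = rowL₁ (rowIdx T (1 - P) (2 - P + T) U₂) ↔ Edge.N = colL₁ (colIdx T (1 - P) (2 - P + T) U₁)) := by
  obtain ⟨P0, P1, T0, T1, V0, V1, W0, W1, one, eP, eT, eV, eW⟩ := g
  obtain ⟨c1, c2, c3, c4, c5, c6⟩ := cut_ne one eP eT eV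
  obtain ⟨d1, d2, d3, d4, d5, d6⟩ := cut_ne one eP eT eW
  have o1 : Od w (T - U₁) := eT.sub_ev eV
  have o2 : Od w (U₂ + 1 + P) := (eW.add_od one).add_ev eP
  have ea : Ev w (U₂ - U₁ + P) := (eW.sub eV).add eP
  have er : U₂ - U₁ + P - (T - U₁) = U₂ - T + P := by ring
  have o3 : Od w (U₂ - T + P) := er ▸ ea.sub_od o1
  rw [← res_reflect (U₂ - U₁ + P) (T - U₁) o1.res_ne_zero (o1.res_ne ea), er]
  rw [res_link (U₂ - U₁ + P) (U₂ - T + P) (U₂ + 1 + P) o3.res_ne_zero o2.res_ne_zero (o3.res_ne ea) (o2.res_ne ea)]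
  have rc : res (U₂ + 1 + P - (U₂ - T + P)) = T + 1 := by
    rw [res_eq _ (0)] <;> push_cast <;> linarith
  rw [rc, show -(U₂ - T + P) = T - P - U₂ by ring, show U₂ - U₁ + P - (U₂ - T + P) = T - U₁ by ring]
  have h1 : res (T - P - U₂) < T + 1 ↔ Edge.N = rowL₁ (rowIdx T (1 - P) (2 - P + T) U₂) := by
    rcases res_cases (T - P - U₂) (by linarith) (by linarith) with h | h | h | h <;>
      simp only [rowIdx] <;> split_ifs <;> simp [rowL₁] <;> grind
  have h2 : res (T - U₁) < T + 1 ↔ Edge.N = colL₁ (colIdx T (1 - P) (2 - P + T) U₁) := by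
    rcases res_cases (T - U₁) (by linarith) (by linarith) with h | h | h | h <;>
      simp only [colIdx] <;> split_ifs <;> simp [colL₁] <;> grind
  rw [h1, h2]

lemma N2 {w : ℤ} {P T U₁ U₂ : ℝ} (g : Gen w P T U₁ U₂) (hT : -1 + P < T) (hT' : T < 1 - P) :
    ¬ (res (U₂ + 1) < res (U₂ - U₁ + P) ↔ res (U₂ + 1 + P) < res (U₂ - U₁ + P)) ↔
      ¬ (Edge.N = rowL₂ (rowIdx (-1 + P) T (1 - P) U₂) ↔ Edge.N = colL₂ (colIdx (-1 + P) T (1 - P) U₁)) := by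
  obtain ⟨P0, P1, T0, T1, V0, V1, W0, W1, one, eP, eT, eV, eW⟩ := g
  obtain ⟨c1, c2, c3, c4, c5, c6⟩ := cut_ne one eP eT eV
  obtain ⟨d1, d2, d3, d4, d5, d6⟩ := cut_ne one eP eT eW
  have o1 : Od w (U₂ + 1) := eW.add_od one
  have o2 : Od w (U₂ + 1 + P) := (eW.add_od one).add_ev eP
  have ea : Ev w (U₂ - U₁ + P) := (eW.sub eV).add eP
  rw [res_link (U₂ - U₁ + P) (U₂ + 1) (U₂ + 1 + P) o1.res_ne_zero o2.res_ne_zero (o1.res_ne ea) (o2.res_ne ea)]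
  have rc : res (U₂ + 1 + P - (U₂ + 1)) = P := by
    rw [res_eq _ (0)] <;> push_cast <;> linarith
  rw [rc, show -(U₂ + 1) = -1 - U₂ by ring, show U₂ - U₁ + P - (U₂ + 1) = P - 1 - U₁ by ring]
  have h1 : res (-1 - U₂) < P ↔ Edge.N = rowL₂ (rowIdx (-1 + P) T (1 - P) U₂) := by
    rcases res_cases (-1 - U₂) (by linarith) (by linarith) with h | h | h | h <;>
      simp only [rowIdx] <;> split_ifs <;> simp [rowL₂] <;> grind
  have h2 : res (P - 1 - U₁) < P ↔ Edge.N = colL₂ (colIdx (-1 + P) T (1 - P) U₁) := by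
    rcases res_cases (P - 1 - U₁) (by linarith) (by linarith) with h | h | h | h <;>
      simp only [colIdx] <;> split_ifs <;> simp [colL₂] <;> grind
  rw [h1, h2]

lemma N3 {w : ℤ} {P T U₁ U₂ : ℝ} (g : Gen w P T U₁ U₂) (hT : 1 - P ≤ T) :
    ¬ (res (T - U₁ + P) < res (U₂ - U₁ + P) ↔ res (U₂ + 1) < res (U₂ - U₁ + P)) ↔
      ¬ (Edge.N = rowL₃ (rowIdx (-2 + P + T) (-1 + P) T U₂) ↔ Edge.N = colL₃ (colIdx (-2 + P + T) (-1 + P) T U₁)) := by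
  obtain ⟨P0, P1, T0, T1, V0, V1, W0, W1, one, eP, eT, eV, eW⟩ := g
  obtain ⟨c1, c2, c3, c4, c5, c6⟩ := cut_ne one eP eT eV
  obtain ⟨d1, d2, d3, d4, d5, d6⟩ := cut_ne one eP eT eW
  have o1 : Od w (T - U₁ + P) := (eT.sub_ev eV).add_ev eP
  have o2 : Od w (U₂ + 1) := eW.add_od one
  have ea : Ev w (U₂ - U₁ + P) := (eW.sub eV).add eP
  have er : U₂ - U₁ + P - (T - U₁ + P) = U₂ - T := by ring
  have o3 : Od w (U₂ - T) := er ▸ ea.sub_od o1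
  rw [← res_reflect (U₂ - U₁ + P) (T - U₁ + P) o1.res_ne_zero (o1.res_ne ea), er]
  rw [not_congr (Iff.comm)]
  rw [res_link (U₂ - U₁ + P) (U₂ + 1) (U₂ - T) o2.res_ne_zero o3.res_ne_zero (o2.res_ne ea) (o3.res_ne ea)]
  have rc : res (U₂ - T - (U₂ + 1)) = 1 - T := by
    rw [res_eq _ (-1)] <;> push_cast <;> linarith
  rw [rc, show -(U₂ + 1) = -1 - U₂ by ring, show U₂ - U₁ + P - (U₂ + 1) = P - 1 - U₁ by ring]
  have h1 : res (-1 - U₂) < 1 - T ↔ Edge.N = rowL₃ (rowIdx (-2 + P + T) (-1 + P) T U₂) := by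
    rcases res_cases (-1 - U₂) (by linarith) (by linarith) with h | h | h | h <;>
      simp only [rowIdx] <;> split_ifs <;> simp [rowL₃] <;> grind
  have h2 : res (P - 1 - U₁) < 1 - T ↔ Edge.N = colL₃ (colIdx (-2 + P + T) (-1 + P) T U₁) := by
    rcases res_cases (P - 1 - U₁) (by linarith) (by linarith) with h | h | h | h <;>
      simp only [colIdx] <;> split_ifs <;> simp [colL₃] <;> grind
  rw [h1, h2]

lemma W1_tie {w : ℤ} {P T U₁ U₂ : ℝ} (g : Gen w P T U₁ U₂) (hT : T = -1 + P) :
    (Edge.W = rowL₁ (rowIdx T (1 - P) (2 - P + T) U₂) ↔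
      Edge.W = colL₁ (colIdx T (1 - P) (2 - P + T) U₁)) := by
  obtain ⟨P0, P1, T0, T1, V0, V1, W0, W1, one, eP, eT, eV, eW⟩ := g
  have h1 : ¬ (Edge.W = rowL₁ (rowIdx T (1 - P) (2 - P + T) U₂)) := by
    simp only [rowIdx]; split_ifs <;> simp [rowL₁] <;> grind
  have h2 : ¬ (Edge.W = colL₁ (colIdx T (1 - P) (2 - P + T) U₁)) := by
    simp only [colIdx]; split_ifs <;> simp [colL₁] <;> grind
  tauto

lemma E3_tie {w : ℤ} {P T U₁ U₂ : ℝ} (g : Gen w P T U₁ U₂) (hT : T = 1 - P) :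
    (Edge.E = rowL₃ (rowIdx (-2 + P + T) (-1 + P) T U₂) ↔
      Edge.E = colL₃ (colIdx (-2 + P + T) (-1 + P) T U₁)) := by
  obtain ⟨P0, P1, T0, T1, V0, V1, W0, W1, one, eP, eT, eV, eW⟩ := g
  obtain ⟨c1, c2, c3, c4, c5, c6⟩ := cut_ne one eP eT eV
  obtain ⟨d1, d2, d3, d4, d5, d6⟩ := cut_ne one eP eT eW
  have h1 : ¬ (Edge.E = rowL₃ (rowIdx (-2 + P + T) (-1 + P) T U₂)) := by
    simp only [rowIdx]; split_ifs <;> simp [rowL₃] <;> grind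
  have h2 : ¬ (Edge.E = colL₃ (colIdx (-2 + P + T) (-1 + P) T U₁)) := by
    simp only [colIdx]; split_ifs <;> simp [colL₃] <;> grind
  tauto

/-- On the wall `T = 1 - P` the partitions of zones 2 and 3 agree. -/
lemma tileLetters_zone3 {w : ℤ} {P T U₁ U₂ : ℝ} (g : Gen w P T U₁ U₂) (hT : 1 - P ≤ T) :
    tileLetters P (T, U₁, U₂) = (rowL₃ (rowIdx (-2 + P + T) (-1 + P) T U₂),
      colL₃ (colIdx (-2 + P + T) (-1 + P) T U₁)) := by
  obtain ⟨P0, P1, T0, T1, V0, V1, W0, W1, one, eP, eT, eV, eW⟩ := g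
  obtain ⟨c1, c2, c3, c4, c5, c6⟩ := cut_ne one eP eT eV
  obtain ⟨d1, d2, d3, d4, d5, d6⟩ := cut_ne one eP eT eW
  have h1 : ¬ T ≤ -1 + P := by linarith
  rcases hT.eq_or_lt with h | h
  · have h2 : T ≤ 1 - P := h.ge
    simp only [tileLetters, if_neg h1, if_pos h2]
    have er : rowL₂ (rowIdx (-1 + P) T (1 - P) U₂) =
        rowL₃ (rowIdx (-2 + P + T) (-1 + P) T U₂) := by
      simp only [rowIdx]; split_ifs <;> simp [rowL₂, rowL₃] <;> grind
    have ec : colL₂ (colIdx (-1 + P) T (1 - P) U₁) =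
        colL₃ (colIdx (-2 + P + T) (-1 + P) T U₁) := by
      simp only [colIdx]; split_ifs <;> simp [colL₂, colL₃] <;> grind
    rw [er, ec]
  · have h2 : ¬ T ≤ 1 - P := by linarith
    simp only [tileLetters, if_neg h1, if_neg h2]

lemma tile_xor (P : ℝ) (c : ℝ × ℝ) (e : Edge) : tileLight P c e ↔
    ¬ (e = (tileLetters P (repΛ P (Xi P c))).1 ↔ e = (tileLetters P (repΛ P (Xi P c))).2) := by
  unfold tileLight
  generalize (tileLetters P (repΛ P (Xi P c))).1 = x
  generalize (tileLetters P (repΛ P (Xi P c))).2 = y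
  constructor
  · rintro ⟨h, rfl | rfl⟩
    · simpa using h
    · simpa using h.symm
  · intro h
    by_cases hx : e = x
    · subst hx
      refine ⟨fun h' => h (by simp [← h']), Or.inl rfl⟩
    · by_cases hy : e = y
      · subst hy
        exact ⟨fun h' => hx h'.symm, Or.inr rfl⟩
      · exact absurd ⟨fun h => absurd h hx, fun h => absurd h hy⟩ h

/-! ### Counting light points -/

lemma ncard_single (C : ℝ → Prop) (x₀ : ℝ) (L : Prop) (h : ∀ x, C x ↔ x = x₀ ∧ L) :
    Set.ncard {x | C x} = if L then 1 else 0 := by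
  by_cases hL : L
  · have : {x | C x} = {x₀} := by ext x; simp [h, hL]
    rw [this, if_pos hL, Set.ncard_singleton]
  · have : {x | C x} = ∅ := by ext x; simp [h, hL]
    rw [this, if_neg hL, Set.ncard_empty]

lemma ncard_double (C : ℝ → Prop) (x₀ x₁ : ℝ) (L₀ L₁ : Prop) (hne : x₀ ≠ x₁)
    (h : ∀ x, C x ↔ (x = x₀ ∧ L₀) ∨ (x = x₁ ∧ L₁)) :
    Set.ncard {x | C x} = (if L₀ then 1 else 0) + (if L₁ then 1 else 0) := by
  by_cases h0 : L₀
  · by_cases h1 : L₁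
    · have : {x | C x} = {x₀, x₁} := by ext x; simp [h, h0, h1]
      rw [this, if_pos h0, if_pos h1, Set.ncard_pair hne]
    · have : {x | C x} = {x₀} := by ext x; simp [h, h0, h1]
      rw [this, if_pos h0, if_neg h1, Set.ncard_singleton]
  · rw [ncard_single C x₁ L₁ (fun x => by simp [h, h0]), if_neg h0, zero_add]

lemma count_xor (A B : Prop) : ((if A then 1 else 0) + (if B then 1 else 0) = 1) ↔ ¬ (A ↔ B) := by
  by_cases hA : A <;> by_cases hB : B <;> simp [hA, hB]

namespace Param

variable (π : Param)

lemma omega_pos : (0 : ℝ) < (π.ω : ℝ) := by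
  have := π.p_pos
  have : 0 < π.ω := by unfold ω; omega
  exact_mod_cast this

lemma P_pos : 0 < π.P := by
  have := π.p_pos
  have h : (0 : ℝ) < π.p := by exact_mod_cast this
  unfold P; have := π.omega_pos; positivity

lemma P_lt_one : π.P < 1 := by
  have h := π.p_lt_q
  have h' : (π.p : ℝ) < π.q := by exact_mod_cast h
  unfold P; rw [div_lt_one π.omega_pos]; unfold ω; push_cast; linarith

lemma Q_eq : π.Q = 2 - π.P := by
  have h := π.omega_pos
  unfold Q P
  field_simp
  unfold ω; push_cast; ring

lemma omega_odd : Odd (π.ω : ℤ) := by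
  have h1 := π.even_pq
  have h2 := π.coprime
  unfold ω
  have : Odd (π.p + π.q) := by
    by_contra h
    rw [Nat.not_odd_iff_even] at h
    have : Even π.p ∧ Even π.q := by
      rw [Nat.even_mul] at h1
      rw [Nat.even_add] at h
      tauto
    have := Nat.dvd_gcd this.1.two_dvd this.2.two_dvd
    rw [h2] at this
    omega
  exact_mod_cast this

lemma ev_P : Ev π.ω π.P := by
  refine ⟨π.p, ?_⟩
  have h := π.omega_pos
  unfold P; push_cast; field_simp

lemma od_one : Od π.ω 1 := by
  obtain ⟨k, hk⟩ := π.omega_odd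
  exact ⟨k, by rw [hk]; push_cast; ring⟩

lemma FP_eq (x y : ℝ) (k : ℤ) (h : y + π.P * x = k) : π.FP (x, y) = nrm (π.P * k + 1) := by
  unfold FP; congr 1; simp only; rw [← h]; ring

lemma FQ_eq (x y : ℝ) (k : ℤ) (h : y + π.Q * x = k) : π.FQ (x, y) = nrm (π.P * k + 1) := by
  unfold FQ; congr 1; simp only; rw [← h]; ring

lemma goodV_int (m n j : ℤ) (h : π.P * m = j) : ¬ π.goodV m n := by
  have h0 : nrm (2 * π.P * m) = 0 := by
    have hr : res (2 * π.P * m) = 0 := by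
      rw [res_congr (y := 0) j (by linarith), res_zero]
    rcases nrm_eq_res (2 * π.P * m) with ⟨h1, h2⟩ | ⟨h1, h2⟩
    · rw [h2, hr]
    · rw [hr] at h1; linarith
  have hl : ∀ b, ¬ lightPair 0 b := by
    intro b hb; simp [lightPair] at hb
  simp [goodV, vLightCount, lightVP, lightVQ, FV, h0, hl]

lemma goodV_iff (m n j : ℤ) (h0 : (j : ℝ) < π.P * m) (h1 : π.P * m < j + 1) :
    π.goodV m n ↔ ¬ (lightPair (nrm (2 * π.P * m)) (nrm (π.P * ((n + j + 1 : ℤ) : ℝ) + 1)) ↔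
      lightPair (nrm (2 * π.P * m)) (nrm (π.P * ((n + 2 * m - j : ℤ) : ℝ) + 1))) := by
  have hQ := π.Q_eq
  unfold goodV vLightCount
  rw [ncard_single _ ((n + j + 1 : ℤ) - π.P * m)
      (lightPair (nrm (2 * π.P * m)) (nrm (π.P * ((n + j + 1 : ℤ) : ℝ) + 1))),
    ncard_single _ ((n + 2 * m - j : ℤ) - π.Q * m)
      (lightPair (nrm (2 * π.P * m)) (nrm (π.P * ((n + 2 * m - j : ℤ) : ℝ) + 1))), count_xor]
  · intro y
    constructor
    · rintro ⟨⟨hy0, hy1⟩, -, ⟨k, hk⟩, hl⟩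
      rw [π.FQ_eq _ _ k hk] at hl
      simp only at hk
      have e : k = n + 2 * m - j := by
        have a1 : (k : ℝ) < ((n + 2 * m - j + 1 : ℤ) : ℝ) := by push_cast; rw [← hk, hQ]; linarith
        have a2 : ((n + 2 * m - j - 1 : ℤ) : ℝ) < k := by push_cast; rw [← hk, hQ]; linarith
        have a1 := Int.cast_lt.mp a1
        have a2 := Int.cast_lt.mp a2
        omega
      subst e
      exact ⟨by linarith, hl⟩
    · rintro ⟨rfl, hl⟩
      have hk : (((n + 2 * m - j : ℤ) : ℝ) - π.Q * m) + π.Q * m = ((n + 2 * m - j : ℤ) : ℝ) := by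
        ring
      refine ⟨⟨?_, ?_⟩, ⟨m, rfl⟩, ⟨_, hk⟩, ?_⟩
      · push_cast; rw [hQ]; linarith
      · push_cast; rw [hQ]; linarith
      · rw [π.FQ_eq _ _ _ hk]; exact hl
  · intro y
    constructor
    · rintro ⟨⟨hy0, hy1⟩, -, ⟨k, hk⟩, hl⟩
      rw [π.FP_eq _ _ k hk] at hl
      simp only at hk
      have e : k = n + j + 1 := by
        have a1 : (k : ℝ) < ((n + j + 2 : ℤ) : ℝ) := by push_cast; rw [← hk]; linarith
        have a2 : ((n + j : ℤ) : ℝ) < k := by push_cast; rw [← hk]; linarith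
        have a1 := Int.cast_lt.mp a1
        have a2 := Int.cast_lt.mp a2
        omega
      subst e
      exact ⟨by linarith, hl⟩
    · rintro ⟨rfl, hl⟩
      have hk : (((n + j + 1 : ℤ) : ℝ) - π.P * m) + π.P * m = ((n + j + 1 : ℤ) : ℝ) := by ring
      refine ⟨⟨?_, ?_⟩, ⟨m, rfl⟩, ⟨_, hk⟩, ?_⟩
      · push_cast; linarith
      · push_cast; linarith
      · rw [π.FP_eq _ _ _ hk]; exact hl

/-- A horizontal segment meeting a `𝓟` line: one point of each type. -/
lemma goodH_one (m n i : ℤ) (h0 : π.P * m ≤ i) (h1 : (i : ℝ) ≤ π.P * (m + 1)) :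
    π.goodH m n ↔ ¬ (lightPair (nrm (2 * π.P * n)) (nrm (π.P * ((n + i : ℤ) : ℝ) + 1)) ↔
      lightPair (nrm (2 * π.P * n)) (nrm (π.P * ((n + 2 * m + 1 - i : ℤ) : ℝ) + 1))) := by
  have hQ := π.Q_eq
  have P0 := π.P_pos
  have P1 := π.P_lt_one
  have Q0 : 0 < π.Q := by linarith
  unfold goodH hLightCount
  rw [ncard_single _ (i / π.P)
      (lightPair (nrm (2 * π.P * n)) (nrm (π.P * ((n + i : ℤ) : ℝ) + 1))),
    ncard_single _ ((2 * m + 1 - i) / π.Q)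
      (lightPair (nrm (2 * π.P * n)) (nrm (π.P * ((n + 2 * m + 1 - i : ℤ) : ℝ) + 1))), count_xor]
  · intro x
    constructor
    · rintro ⟨⟨hx0, hx1⟩, ⟨-, ⟨k, hk⟩, hl⟩, hmid⟩
      rw [π.FQ_eq _ _ k hk] at hl
      simp only at hk
      have q0 : π.Q * m ≤ π.Q * x := mul_le_mul_of_nonneg_left hx0 Q0.le
      have q1 : π.Q * x ≤ π.Q * (m + 1) := mul_le_mul_of_nonneg_left hx1 Q0.le
      have e : k = n + 2 * m + 1 - i := by
        have a1 : (k : ℝ) < ((n + 2 * m + 2 - i : ℤ) : ℝ) := by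
          by_contra hcon
          push_cast at hcon
          have q2 : π.Q * x = π.Q * (m + 1) := by rw [hQ] at *; linarith
          have q3 : x = m + 1 := mul_left_cancel₀ Q0.ne' q2
          have := hmid ⟨n + i, by push_cast; rw [q3]; rw [hQ] at *; linarith⟩
          linarith
        have a2 : ((n + 2 * m - i : ℤ) : ℝ) < k := by
          by_contra hcon
          push_cast at hcon
          have q2 : π.Q * x = π.Q * m := by rw [hQ] at *; linarith
          have q3 : x = m := mul_left_cancel₀ Q0.ne' q2
          have := hmid ⟨n + i, by push_cast; rw [q3]; rw [hQ] at *; linarith⟩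
          linarith
        have a1 := Int.cast_lt.mp a1
        have a2 := Int.cast_lt.mp a2
        omega
      subst e
      refine ⟨?_, hl⟩
      rw [eq_div_iff Q0.ne']
      push_cast at hk
      linarith
    · rintro ⟨hx, hl⟩
      rw [eq_div_iff Q0.ne'] at hx
      have hk : (n : ℝ) + π.Q * x = ((n + 2 * m + 1 - i : ℤ) : ℝ) := by push_cast; linarith
      have b0 : (m : ℝ) ≤ x := by
        refine le_of_mul_le_mul_right ?_ Q0
        rw [hx, hQ]; linarith
      have b1 : x ≤ m + 1 := by
        refine le_of_mul_le_mul_right ?_ Q0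
        rw [hx, hQ]; linarith
      refine ⟨⟨b0, b1⟩, ⟨⟨n, rfl⟩, ⟨_, hk⟩, ?_⟩, ?_⟩
      · rw [π.FQ_eq _ _ _ hk]; exact hl
      · rintro ⟨l, hl'⟩
        simp only at hl'
        have h2x : 2 * x = ((l - n + 2 * m + 1 - i : ℤ) : ℝ) := by
          push_cast; rw [hQ] at hx; linarith
        have c0 : x ≠ m := by
          rintro rfl
          rw [hQ] at hx; linarith
        have c1 : x ≠ m + 1 := by
          rintro rfl
          rw [hQ] at hx; linarith
        have b0 := lt_of_le_of_ne b0 c0.symm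
        have b1 := lt_of_le_of_ne b1 c1
        have d0 : ((2 * m : ℤ) : ℝ) < ((l - n + 2 * m + 1 - i : ℤ) : ℝ) := by
          rw [← h2x]; push_cast; linarith
        have d1 : ((l - n + 2 * m + 1 - i : ℤ) : ℝ) < ((2 * m + 2 : ℤ) : ℝ) := by
          rw [← h2x]; push_cast; linarith
        have d0 := Int.cast_lt.mp d0
        have d1 := Int.cast_lt.mp d1
        have d : l - n + 2 * m + 1 - i = 2 * m + 1 := by omega
        rw [d] at h2x
        push_cast at h2x
        linarith
  · intro x
    constructor
    · rintro ⟨⟨hx0, hx1⟩, -, ⟨k, hk⟩, hl⟩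
      rw [π.FP_eq _ _ k hk] at hl
      simp only at hk
      have q0 : π.P * m ≤ π.P * x := mul_le_mul_of_nonneg_left hx0 P0.le
      have q1 : π.P * x ≤ π.P * (m + 1) := mul_le_mul_of_nonneg_left hx1 P0.le
      have e : k = n + i := by
        have a1 : (k : ℝ) < ((n + i + 1 : ℤ) : ℝ) := by push_cast; linarith
        have a2 : ((n + i - 1 : ℤ) : ℝ) < k := by push_cast; linarith
        have a1 := Int.cast_lt.mp a1
        have a2 := Int.cast_lt.mp a2
        omega
      subst e
      refine ⟨?_, hl⟩
      rw [eq_div_iff P0.ne']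
      push_cast at hk
      linarith
    · rintro ⟨hx, hl⟩
      rw [eq_div_iff P0.ne'] at hx
      have hk : (n : ℝ) + π.P * x = ((n + i : ℤ) : ℝ) := by push_cast; linarith
      refine ⟨⟨?_, ?_⟩, ⟨n, rfl⟩, ⟨_, hk⟩, ?_⟩
      · refine le_of_mul_le_mul_right ?_ P0
        rw [hx]; linarith
      · refine le_of_mul_le_mul_right ?_ P0
        rw [hx]; linarith
      · rw [π.FP_eq _ _ _ hk]; exact hl

/-- A horizontal segment meeting no `𝓟` line: two points of type `Q`. -/
lemma goodH_two (m n j : ℤ) (h0 : (j : ℝ) < π.P * m) (h1 : π.P * (m + 1) < j + 1) :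
    π.goodH m n ↔
      ¬ (lightPair (nrm (2 * π.P * n)) (nrm (π.P * ((n + 2 * m - j : ℤ) : ℝ) + 1)) ↔
        lightPair (nrm (2 * π.P * n)) (nrm (π.P * ((n + 2 * m + 1 - j : ℤ) : ℝ) + 1))) := by
  have hQ := π.Q_eq
  have P0 := π.P_pos
  have P1 := π.P_lt_one
  have Q0 : 0 < π.Q := by linarith
  have noP : ∀ x : ℝ, (m : ℝ) ≤ x → x ≤ m + 1 → ¬ π.onP (x, (n : ℝ)) := by
    rintro x hx0 hx1 ⟨k, hk⟩
    simp only at hk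
    have q0 : π.P * m ≤ π.P * x := mul_le_mul_of_nonneg_left hx0 P0.le
    have q1 : π.P * x ≤ π.P * (m + 1) := mul_le_mul_of_nonneg_left hx1 P0.le
    have a1 : (k : ℝ) < ((n + j + 1 : ℤ) : ℝ) := by push_cast; linarith
    have a2 : ((n + j : ℤ) : ℝ) < k := by push_cast; linarith
    have a1 := Int.cast_lt.mp a1
    have a2 := Int.cast_lt.mp a2
    omega
  unfold goodH hLightCount
  rw [ncard_single _ 0 False,
    ncard_double _ ((2 * m - j) / π.Q) ((2 * m + 1 - j) / π.Q)
      (lightPair (nrm (2 * π.P * n)) (nrm (π.P * ((n + 2 * m - j : ℤ) : ℝ) + 1)))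
      (lightPair (nrm (2 * π.P * n)) (nrm (π.P * ((n + 2 * m + 1 - j : ℤ) : ℝ) + 1))),
    if_neg not_false, zero_add, count_xor]
  · intro h
    rw [div_left_inj' Q0.ne'] at h
    linarith
  · intro x
    constructor
    · rintro ⟨⟨hx0, hx1⟩, ⟨-, ⟨k, hk⟩, hl⟩, -⟩
      rw [π.FQ_eq _ _ k hk] at hl
      simp only at hk
      have q0 : π.Q * m ≤ π.Q * x := mul_le_mul_of_nonneg_left hx0 Q0.le
      have q1 : π.Q * x ≤ π.Q * (m + 1) := mul_le_mul_of_nonneg_left hx1 Q0.le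
      have e : k = n + 2 * m - j ∨ k = n + 2 * m + 1 - j := by
        have a1 : (k : ℝ) < ((n + 2 * m + 2 - j : ℤ) : ℝ) := by
          push_cast; rw [hQ] at *; linarith
        have a2 : ((n + 2 * m - j - 1 : ℤ) : ℝ) < k := by
          push_cast; rw [hQ] at *; linarith
        have a1 := Int.cast_lt.mp a1
        have a2 := Int.cast_lt.mp a2
        omega
      rcases e with e | e
      · subst e
        refine Or.inl ⟨?_, hl⟩
        rw [eq_div_iff Q0.ne']
        push_cast at hk
        linarith
      · subst e
        refine Or.inr ⟨?_, hl⟩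
        rw [eq_div_iff Q0.ne']
        push_cast at hk
        linarith
    · rintro (⟨hx, hl⟩ | ⟨hx, hl⟩)
      all_goals
        rw [eq_div_iff Q0.ne'] at hx
        have b0 : (m : ℝ) ≤ x := by
          refine le_of_mul_le_mul_right ?_ Q0
          rw [hx, hQ]; linarith
        have b1 : x ≤ m + 1 := by
          refine le_of_mul_le_mul_right ?_ Q0
          rw [hx, hQ]; linarith
      · have hk : (n : ℝ) + π.Q * x = ((n + 2 * m - j : ℤ) : ℝ) := by push_cast; linarith
        refine ⟨⟨b0, b1⟩, ⟨⟨n, rfl⟩, ⟨_, hk⟩, ?_⟩, fun h => absurd h (noP x b0 b1)⟩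
        rw [π.FQ_eq _ _ _ hk]; exact hl
      · have hk : (n : ℝ) + π.Q * x = ((n + 2 * m + 1 - j : ℤ) : ℝ) := by push_cast; linarith
        refine ⟨⟨b0, b1⟩, ⟨⟨n, rfl⟩, ⟨_, hk⟩, ?_⟩, fun h => absurd h (noP x b0 b1)⟩
        rw [π.FQ_eq _ _ _ hk]; exact hl
  · intro x
    constructor
    · rintro ⟨⟨hx0, hx1⟩, -, hP, -⟩
      exact (noP x hx0 hx1 hP).elim
    · rintro ⟨-, h⟩
      exact h.elim

end Param

lemma bridge {w : ℤ} {a b c : ℝ} (a' b' c' : ℝ) (one : Od w 1) (ha : Ev w a) (hb : Od w b)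
    (hc : Od w c) (ka kb kc : ℤ) (ea : a' = a + 2 * ka) (eb : b' = b + 2 * kb)
    (ec : c' = c + 2 * kc) :
    ¬ (lightPair (nrm a') (nrm b') ↔ lightPair (nrm a') (nrm c')) ↔
      ¬ (res b < res a ↔ res c < res a) := by
  have ra := res_congr ka ea
  have rb := res_congr kb eb
  have rc := res_congr kc ec
  rw [light_xor, ra, rb, rc]
  · rw [rb]; exact hb.res_ne_zero
  · rw [ra, rb]; exact hb.res_ne ha
  · rw [rc]; exact hc.res_ne_zero
  · rw [ra, rc]; exact hc.res_ne ha
  · rw [ra]; exact one.ne ha.of_res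

set_option maxHeartbeats 2000000 in
/-- The grid light set agrees with the tile light set, edge by edge. -/
lemma grid_iff_tile (π : Param) (m n : ℤ) (e : Edge) :
    gridGood π m n e ↔ tileLight π.P ((m : ℝ) + 1 / 2, (n : ℝ) + 1 / 2) e := by
  rw [tile_xor]
  obtain ⟨j, hj⟩ : ∃ j : ℤ, j = ⌊π.P * (m + 1 / 2)⌋ := ⟨_, rfl⟩
  have hj0 : (j : ℝ) ≤ π.P * (m + 1 / 2) := by rw [hj]; exact Int.floor_le _
  have hj1 : π.P * (m + 1 / 2) < j + 1 := by rw [hj]; exact Int.lt_floor_add_one _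
  have hfl : ⌊(2 * π.P * ((m : ℝ) + 1 / 2) + 2 * ((n : ℝ) + 1 / 2) + 1) / 2⌋ = n + 1 + j := by
    rw [Int.floor_eq_iff]; push_cast; constructor <;> linarith
  obtain ⟨T, hT⟩ : ∃ T, T = (repΛ π.P (Xi π.P ((m : ℝ) + 1 / 2, (n : ℝ) + 1 / 2))).1 := ⟨_, rfl⟩
  obtain ⟨U₁, hU₁⟩ : ∃ U, U = (repΛ π.P (Xi π.P ((m : ℝ) + 1 / 2, (n : ℝ) + 1 / 2))).2.1 :=
    ⟨_, rfl⟩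
  obtain ⟨U₂, hU₂⟩ : ∃ U, U = (repΛ π.P (Xi π.P ((m : ℝ) + 1 / 2, (n : ℝ) + 1 / 2))).2.2 :=
    ⟨_, rfl⟩
  have hrep : repΛ π.P (Xi π.P ((m : ℝ) + 1 / 2, (n : ℝ) + 1 / 2)) = (T, U₁, U₂) := by
    rw [hT, hU₁, hU₂]
  rw [hrep]
  simp only [repΛ, Xi] at hT hU₁ hU₂
  rw [hfl] at hU₁ hU₂
  have hTb : -1 ≤ T ∧ T < 1 := hT ▸ nrm_bounds _
  have hU₁b : -1 ≤ U₁ ∧ U₁ < 1 := hU₁ ▸ nrm_bounds _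
  have hU₂b : -1 ≤ U₂ ∧ U₂ < 1 := hU₂ ▸ nrm_bounds _
  unfold nrm at hT
  rw [hfl] at hT
  push_cast at hT
  obtain ⟨s, hs⟩ := nrm_spec
    (2 * π.P * ((m : ℝ) + 1 / 2) - ((n + 1 + j : ℤ) : ℝ) * π.P)
  obtain ⟨t, ht⟩ := nrm_spec
    (2 * π.P * ((m : ℝ) + 1 / 2) + 2 * π.P * ((n : ℝ) + 1 / 2) - ((n + 1 + j : ℤ) : ℝ) * π.P)
  rw [hs] at hU₁
  rw [ht] at hU₂
  push_cast at hU₁ hU₂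
  have P0 := π.P_pos
  have P1 := π.P_lt_one
  have one := π.od_one
  have eP := π.ev_P
  have eT : Od π.ω T := by
    have := ((eP.mul_int (2 * m + 1)).sub (Ev.two_mul_int j)).sub_od one
    convert this using 1
    rw [hT]; push_cast; ring
  have eV : Ev π.ω U₁ := by
    have := (eP.mul_int (2 * m + 1 - (n + 1 + j))).add (Ev.two_mul_int s)
    convert this using 1
    rw [hU₁]; push_cast; ring
  have eW : Ev π.ω U₂ := by
    have := (eP.mul_int (2 * m + 2 * n + 2 - (n + 1 + j))).add (Ev.two_mul_int t)
    convert this using 1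
    rw [hU₂]; push_cast; ring
  have g : Gen π.ω π.P T U₁ U₂ :=
    ⟨P0, P1, hTb.1, hTb.2, hU₁b.1, hU₁b.2, hU₂b.1, hU₂b.2, one, eP, eT, eV, eW⟩
  -- parities of all the values which occur
  have aW : Ev π.ω (T + 1 - π.P) := (eT.add one).sub eP
  have aE : Ev π.ω (T + 1 + π.P) := (eT.add one).add eP
  have aS : Ev π.ω (U₂ - U₁ - π.P) := (eW.sub eV).sub eP
  have aN : Ev π.ω (U₂ - U₁ + π.P) := (eW.sub eV).add eP
  have oP : Od π.ω (T - U₁) := eT.sub_ev eV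
  have oPm := oP.sub_ev eP
  have oPp := oP.add_ev eP
  have oQ : Od π.ω (U₂ + 1) := eW.add_od one
  have oQm := oQ.sub_ev eP
  have oQp := oQ.add_ev eP
  rcases le_or_gt T (-1 + π.P) with hz | hz
  · -- zone 1
    have htl : tileLetters π.P (T, U₁, U₂) =
        (rowL₁ (rowIdx T (1 - π.P) (2 - π.P + T) U₂),
          colL₁ (colIdx T (1 - π.P) (2 - π.P + T) U₁)) := by
      simp only [tileLetters, if_pos hz]
    rw [htl]
    cases e
    · simp only [gridGood]
      rw [π.goodH_one m (n + 1) j (by linarith) (by linarith), ← N1 g hz]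
      exact bridge _ _ _ one aN oP oQp (s - t) (j + 1 + s) (-t)
        (by push_cast; linarith) (by push_cast; linarith) (by push_cast; linarith)
    · simp only [gridGood]
      rw [π.goodH_one m n j (by linarith) (by linarith), ← S1 g hz]
      exact bridge _ _ _ one aS oPm oQ (s - t) (j + 1 + s) (-t)
        (by push_cast; linarith) (by push_cast; linarith) (by push_cast; linarith)
    · simp only [gridGood]
      rw [π.goodV_iff (m + 1) n j (by push_cast; linarith) (by push_cast; linarith), ← E1 g hz]
      exact bridge _ _ _ one aE oP oQp j (j + 1 + s) (-t)
        (by push_cast; linarith) (by push_cast; linarith) (by push_cast; linarith)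
    · simp only [gridGood]
      rcases hz.eq_or_lt with h | h
      · have h1 := W1_tie g h
        have h2 := π.goodV_int m n j (by linarith)
        tauto
      · rw [π.goodV_iff m n (j - 1) (by push_cast; linarith) (by push_cast; linarith), ← W1 g h]
        exact bridge _ _ _ one aW oPm oQ j (j + 1 + s) (-t)
          (by push_cast; linarith) (by push_cast; linarith) (by push_cast; linarith)
  rcases lt_or_ge T (1 - π.P) with hz' | hz'
  · -- zone 2
    have htl : tileLetters π.P (T, U₁, U₂) =
        (rowL₂ (rowIdx (-1 + π.P) T (1 - π.P) U₂),
          colL₂ (colIdx (-1 + π.P) T (1 - π.P) U₁)) := by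
      simp only [tileLetters, if_neg (not_le.mpr hz), if_pos hz'.le]
    rw [htl]
    cases e
    · simp only [gridGood]
      rw [π.goodH_two m (n + 1) j (by linarith) (by linarith), ← N2 g hz hz']
      exact bridge _ _ _ one aN oQ oQp (s - t) (-t) (-t)
        (by push_cast; linarith) (by push_cast; linarith) (by push_cast; linarith)
    · simp only [gridGood]
      rw [π.goodH_two m n j (by linarith) (by linarith), ← S2 g hz hz']
      exact bridge _ _ _ one aS oQm oQ (s - t) (-t) (-t)
        (by push_cast; linarith) (by push_cast; linarith) (by push_cast; linarith)
    · simp only [gridGood]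
      rw [π.goodV_iff (m + 1) n j (by push_cast; linarith) (by push_cast; linarith),
        ← E2 g hz hz']
      exact bridge _ _ _ one aE oP oQp j (j + 1 + s) (-t)
        (by push_cast; linarith) (by push_cast; linarith) (by push_cast; linarith)
    · simp only [gridGood]
      rw [π.goodV_iff m n j (by linarith) (by linarith), ← W2 g hz hz']
      exact bridge _ _ _ one aW oP oQm j (j + 1 + s) (-t)
        (by push_cast; linarith) (by push_cast; linarith) (by push_cast; linarith)
  · -- zone 3
    rw [tileLetters_zone3 g hz']
    cases e
    · simp only [gridGood]
      rw [π.goodH_one m (n + 1) (j + 1) (by push_cast; linarith) (by push_cast; linarith),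
        ← N3 g hz']
      exact bridge _ _ _ one aN oPp oQ (s - t) (j + 1 + s) (-t)
        (by push_cast; linarith) (by push_cast; linarith) (by push_cast; linarith)
    · simp only [gridGood]
      rw [π.goodH_one m n (j + 1) (by push_cast; linarith) (by push_cast; linarith), ← S3 g hz']
      exact bridge _ _ _ one aS oP oQm (s - t) (j + 1 + s) (-t)
        (by push_cast; linarith) (by push_cast; linarith) (by push_cast; linarith)
    · simp only [gridGood]
      rcases hz'.eq_or_lt with h | h
      · have h1 := E3_tie g h.symm
        have h2 := π.goodV_int (m + 1) n (j + 1) (by push_cast; linarith)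
        tauto
      · rw [π.goodV_iff (m + 1) n (j + 1) (by push_cast; linarith) (by push_cast; linarith),
          ← E3 g h]
        exact bridge _ _ _ one aE oPp oQ j (j + 1 + s) (-t)
          (by push_cast; linarith) (by push_cast; linarith) (by push_cast; linarith)
    · simp only [gridGood]
      rw [π.goodV_iff m n j (by linarith) (by linarith), ← W3 g hz']
      exact bridge _ _ _ one aW oP oQm j (j + 1 + s) (-t)
        (by push_cast; linarith) (by push_cast; linarith) (by push_cast; linarith)

/-- **The Isomorphism Theorem.**  For every even rational parameter `p/q` and every integer
unit square, the grid light set of the square coincides with its tile light set.  In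
particular (since a tile has either no connector or a connector joining two distinct edges),
every integer unit square has either `0` or `2` good edges. -/
theorem isomorphism (π : Param) (m n : ℤ) :
    (∀ e : Edge, gridGood π m n e ↔ tileLight π.P ((m : ℝ) + 1 / 2, (n : ℝ) + 1 / 2) e) ∧
    ((if π.goodH m n then 1 else 0) + (if π.goodH m (n + 1) then 1 else 0) +
        (if π.goodV m n then 1 else 0) + (if π.goodV (m + 1) n then 1 else 0) = 0 ∨
     (if π.goodH m n then 1 else 0) + (if π.goodH m (n + 1) then 1 else 0) +
        (if π.goodV m n then 1 else 0) + (if π.goodV (m + 1) n then 1 else 0) = 2) := by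
  refine ⟨grid_iff_tile π m n, ?_⟩
  have hS := grid_iff_tile π m n .S
  have hN := grid_iff_tile π m n .N
  have hW := grid_iff_tile π m n .W
  have hE := grid_iff_tile π m n .E
  simp only [gridGood, tileLight] at hS hN hW hE
  simp only [hS, hN, hW, hE]
  generalize (tileLetters π.P (repΛ π.P (Xi π.P ((m : ℝ) + 1 / 2, (n : ℝ) + 1 / 2)))).1 = x
  generalize (tileLetters π.P (repΛ π.P (Xi π.P ((m : ℝ) + 1 / 2, (n : ℝ) + 1 / 2)))).2 = y
  cases x <;> cases y <;> simp
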